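/- Let p be a prime and let k be a field of characteristic p. Let A := k[x₁,x₂,x₃,x₄]/(x₁x₄ − x₂x₃, x₁^p + x₄x₃^{p−1}). Then the localization of A away from (the image of) x₁ is isomorphic as a k-algebra to the localization of the polynomial ring k[x₁,x₃] away from x₁x₃. In particular, the localization of A away from x₁ is an integral domain. -/

import Mathlib

/-- A ring homomorphism applied to a negated product of powers. -/
lemma map_neg_pow_mul_pow {R S : Type*} [CommRing R] [CommRing S] (g : R →+* S) (x v : R)
    (a : S) (h : g x = a) (m n : ℕ) : g (- x ^ m * v ^ n) = - a ^ m * g v ^ n := by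
  rw [map_mul, map_neg, map_pow, map_pow, h]

set_option maxHeartbeats 1000000 in
/-- let `p` be a prime and `k` a field of characteristic `p`.  For
`A = k[x₁,x₂,x₃,x₄]/(x₁x₄ - x₂x₃, x₁^p + x₄x₃^{p-1})`, the localization of `A` away from
`x₁` is isomorphic as a `k`-algebra to the localization of `k[x₁,x₃]` away from `x₁x₃`;
in particular it is an integral domain.  (Variables `x₁,x₂,x₃,x₄` are `X 0, X 1, X 2, X 3`,
and in the two-variable ring `x₁,x₃` are `X 0, X 1`.) -/
theorem statement_17 (p : ℕ) (hp : p.Prime) (k : Type*) [Field k] [CharP k p]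
    (I : Ideal (MvPolynomial (Fin 4) k))
    (hI : I = Ideal.span
      {MvPolynomial.X 0 * MvPolynomial.X 3 - MvPolynomial.X 1 * MvPolynomial.X 2,
        MvPolynomial.X 0 ^ p + MvPolynomial.X 3 * MvPolynomial.X 2 ^ (p - 1)}) :
    Nonempty ((Localization.Away (Ideal.Quotient.mk I (MvPolynomial.X 0))) ≃ₐ[k]
        (Localization.Away (MvPolynomial.X 0 * MvPolynomial.X 1 : MvPolynomial (Fin 2) k))) ∧
      IsDomain (Localization.Away (Ideal.Quotient.mk I (MvPolynomial.X 0))) := by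
  classical
  have hp1 : 1 ≤ p := hp.one_lt.le
  obtain ⟨q, rfl⟩ : ∃ q, p = q + 1 := ⟨p - 1, by omega⟩
  rw [Nat.add_sub_cancel] at hI
  let B := Localization.Away (Ideal.Quotient.mk I (MvPolynomial.X 0))
  let L := Localization.Away (MvPolynomial.X 0 * MvPolynomial.X 1 : MvPolynomial (Fin 2) k)
  -- the generators of `L`
  let x : L := algebraMap (MvPolynomial (Fin 2) k) L (MvPolynomial.X 0)
  let y : L := algebraMap (MvPolynomial (Fin 2) k) L (MvPolynomial.X 1)
  have hxy : IsUnit (x * y) := by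
    have := IsLocalization.Away.algebraMap_isUnit (S := L)
      (MvPolynomial.X 0 * MvPolynomial.X 1 : MvPolynomial (Fin 2) k)
    rwa [map_mul] at this
  have hx : IsUnit x := isUnit_of_mul_isUnit_left hxy
  have hy : IsUnit y := isUnit_of_mul_isUnit_right hxy
  obtain ⟨v, hv⟩ := hy.exists_right_inv
  -- the generators of `B`
  let a : Fin 4 → B := fun i => algebraMap (MvPolynomial (Fin 4) k ⧸ I) B
    (Ideal.Quotient.mk I (MvPolynomial.X i))
  have ha0 : IsUnit (a 0) := IsLocalization.Away.algebraMap_isUnit (S := B) _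
  have r1 : a 0 * a 3 - a 1 * a 2 = 0 := by
    have : Ideal.Quotient.mk I (MvPolynomial.X 0 * MvPolynomial.X 3
        - MvPolynomial.X 1 * MvPolynomial.X 2) = 0 :=
      Ideal.Quotient.eq_zero_iff_mem.2 (hI ▸ Ideal.subset_span (by simp))
    have := congrArg (algebraMap (MvPolynomial (Fin 4) k ⧸ I) B) this
    simpa only [map_sub, map_mul, map_zero] using this
  have r2 : a 0 ^ (q + 1) + a 3 * a 2 ^ q = 0 := by
    have : Ideal.Quotient.mk I (MvPolynomial.X 0 ^ (q + 1)
        + MvPolynomial.X 3 * MvPolynomial.X 2 ^ q) = 0 :=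
      Ideal.Quotient.eq_zero_iff_mem.2 (hI ▸ Ideal.subset_span (by simp))
    have := congrArg (algebraMap (MvPolynomial (Fin 4) k ⧸ I) B) this
    simpa only [map_add, map_mul, map_pow, map_zero] using this
  have r3 : a 0 ^ (q + 2) = a 2 * (- a 1 * a 2 ^ q) := by
    linear_combination a 0 * r2 - a 2 ^ q * r1
  have ha2 : IsUnit (a 2) := by
    have h := ha0.pow (q + 2)
    rw [r3] at h
    exact isUnit_of_mul_isUnit_left h
  -- forward map
  let f0 : MvPolynomial (Fin 4) k →ₐ[k] L :=
    MvPolynomial.aeval ![x, - x ^ (q + 2) * v ^ (q + 1), y, - x ^ (q + 1) * v ^ q]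
  have hf0 : ∀ z ∈ I, f0 z = 0 := by
    intro z hz
    have hle : I ≤ RingHom.ker f0 := by
      rw [hI, Ideal.span_le]
      rintro z (rfl | rfl)
      · simp only [SetLike.mem_coe, RingHom.mem_ker, f0, map_sub, map_mul, MvPolynomial.aeval_X]
        simp only [Matrix.cons_val]
        linear_combination (x ^ (q + 2) * v ^ q) * hv
      · simp only [SetLike.mem_coe, RingHom.mem_ker, f0, map_add, map_pow, map_mul,
          MvPolynomial.aeval_X]
        simp only [Matrix.cons_val]
        have h : y ^ q * v ^ q = 1 := by rw [← mul_pow, hv, one_pow]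
        linear_combination (-x ^ (q + 1)) * h
    exact hle hz
  let f1 : (MvPolynomial (Fin 4) k ⧸ I) →ₐ[k] L := Ideal.Quotient.liftₐ I f0 hf0
  have f1X : ∀ i, f1 (Ideal.Quotient.mk I (MvPolynomial.X i)) =
      ![x, - x ^ (q + 2) * v ^ (q + 1), y, - x ^ (q + 1) * v ^ q] i := fun i =>
    (Ideal.Quotient.lift_mk I _ _).trans (MvPolynomial.aeval_X _ i)
  let f : B →ₐ[k] L := IsLocalization.liftAlgHom
    (M := Submonoid.powers (Ideal.Quotient.mk I (MvPolynomial.X 0))) (f := f1) (by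
      rintro ⟨_, n, rfl⟩
      simp only [map_pow, f1X]
      exact hx.pow n)
  have fa : ∀ i, f (a i) = ![x, - x ^ (q + 2) * v ^ (q + 1), y, - x ^ (q + 1) * v ^ q] i := by
    intro i
    rw [← f1X]
    exact IsLocalization.lift_eq _ _
  -- backward map
  let g0 : MvPolynomial (Fin 2) k →ₐ[k] B := MvPolynomial.aeval ![a 0, a 2]
  let g : L →ₐ[k] B := IsLocalization.liftAlgHom
    (M := Submonoid.powers (MvPolynomial.X 0 * MvPolynomial.X 1 : MvPolynomial (Fin 2) k))
    (f := g0) (by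
      rintro ⟨_, n, rfl⟩
      simp only [map_pow, map_mul, g0, MvPolynomial.aeval_X]
      exact (ha0.mul ha2).pow n)
  have gx : g x = a 0 := (IsLocalization.lift_eq _ _).trans (MvPolynomial.aeval_X _ _)
  have gy : g y = a 2 := (IsLocalization.lift_eq _ _).trans (MvPolynomial.aeval_X _ _)
  have gv : a 2 * g v = 1 := by rw [← gy, ← map_mul, hv, map_one]
  have gvq : a 2 ^ q * g v ^ q = 1 := by rw [← mul_pow, gv, one_pow]
  have h1 : f.comp g = AlgHom.id k L := by
    apply IsLocalization.algHom_ext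
      (Submonoid.powers (MvPolynomial.X 0 * MvPolynomial.X 1 : MvPolynomial (Fin 2) k))
    apply MvPolynomial.algHom_ext
    intro i
    fin_cases i
    · change f (g x) = x
      rw [gx, fa]; rfl
    · change f (g y) = y
      rw [gy, fa]; rfl
  have h2 : g.comp f = AlgHom.id k B := by
    apply IsLocalization.algHom_ext
      (Submonoid.powers (Ideal.Quotient.mk I (MvPolynomial.X 0)))
    apply Ideal.Quotient.algHom_ext
    apply MvPolynomial.algHom_ext
    intro i
    change g (f (a i)) = a i
    rw [fa]
    fin_cases i
    · exact gx
    · change g (- x ^ (q + 2) * v ^ (q + 1)) = a 1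
      refine (map_neg_pow_mul_pow (g : L →+* B) x v (a 0) gx (q + 2) (q + 1)).trans ?_
      change - a 0 ^ (q + 2) * g v ^ (q + 1) = a 1
      rw [r3]
      linear_combination (a 1 * (a 2 * g v)) * gvq + a 1 * gv
    · exact gy
    · change g (- x ^ (q + 1) * v ^ q) = a 3
      refine (map_neg_pow_mul_pow (g : L →+* B) x v (a 0) gx (q + 1) q).trans ?_
      change - a 0 ^ (q + 1) * g v ^ q = a 3
      linear_combination (-g v ^ q) * r2 + a 3 * gvq
  let e : B ≃ₐ[k] L := AlgEquiv.ofAlgHom f g h1 h2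
  refine ⟨⟨e⟩, ?_⟩
  have hL : IsDomain L := IsLocalization.isDomain_localization
    (powers_le_nonZeroDivisors_of_noZeroDivisors
      (mul_ne_zero (MvPolynomial.X_ne_zero 0) (MvPolynomial.X_ne_zero 1)))
  exact e.toMulEquiv.isDomain L
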